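/- arXiv:2404.05645 — 2 statements merged into one kernel-verified Lean document; each statement's English description precedes it below -/
import Mathlib

section
/- Let X be a nonempty compact metric space, f : X → X a continuous map, ψ : X → ℝ a continuous function, and c ∈ ℝ. Suppose that for every integer N there exist an integer n ≥ N and a point x ∈ X with Σ_{k=0}^{n−1} ψ(f^[k](x)) ≤ c·n. Then there exists an f-invariant Borel probability measure μ on X with ∫ ψ dμ ≤ c. -/
open MeasureTheory

open Filter Topology BoundedContinuousFunction

/-- The empirical measure of the orbit segment `x, f x, …, f^[n - 1] x`. -/
noncomputable def orbitEmpiricalMeasure {X : Type*} [MeasurableSpace X]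
    (f : X → X) (n : ℕ) (x : X) : Measure X :=
  (n : ENNReal)⁻¹ • ∑ k ∈ Finset.range n, Measure.dirac (f^[k] x)

theorem isProbabilityMeasure_orbitEmpiricalMeasure {X : Type*} [MeasurableSpace X]
    (f : X → X) {n : ℕ} (hn : n ≠ 0) (x : X) :
    IsProbabilityMeasure (orbitEmpiricalMeasure f n x) := by
  constructor
  simp [orbitEmpiricalMeasure, ENNReal.inv_mul_cancel, hn]

theorem integral_orbitEmpiricalMeasure {X : Type*} [MeasurableSpace X]
    [MeasurableSingletonClass X] (f : X → X) (n : ℕ) (x : X) (g : X → ℝ) :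
    ∫ a, g a ∂(orbitEmpiricalMeasure f n x) = birkhoffAverage ℝ f g n x := by
  rw [orbitEmpiricalMeasure, integral_smul_measure,
    integral_finsetSum_measure fun k _ => integrable_dirac (by simp)]
  simp [birkhoffAverage, birkhoffSum]

/-- A weak limit of empirical measures along orbit segments whose lengths tend to infinity
is invariant. -/
theorem map_eq_of_tendsto_orbitEmpiricalMeasure {X ι : Type*} [TopologicalSpace X]
    [MeasurableSpace X] [BorelSpace X] [HasOuterApproxClosed X] [MeasurableSingletonClass X]
    {f : X → X} (hf : Continuous f) {l : Filter ι} [l.NeBot] {n : ι → ℕ}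
    (hn : Tendsto n l atTop) {x : ι → X} {ν : ι → ProbabilityMeasure X}
    (hν : ∀ i, (ν i : Measure X) = orbitEmpiricalMeasure f (n i) (x i))
    {μ : ProbabilityMeasure X} (hμ : Tendsto ν l (𝓝 μ)) :
    (μ : Measure X).map f = μ := by
  have := Measure.isProbabilityMeasure_map (μ := (μ : Measure X)) hf.aemeasurable
  refine ext_of_forall_integral_eq_of_IsFiniteMeasure fun g => ?_
  rw [integral_map hf.aemeasurable g.continuous.aestronglyMeasurable]
  rw [ProbabilityMeasure.tendsto_iff_forall_integral_tendsto] at hμ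
  have hlim := (hμ (g.compContinuous ⟨f, hf⟩)).sub (hμ g)
  refine sub_eq_zero.1 (tendsto_nhds_unique hlim (squeeze_zero_norm (fun i => ?_)
    (((tendsto_const_nhds (x := 2 * ‖g‖)).div_atTop tendsto_natCast_atTop_atTop).comp hn)))
  have hshift : birkhoffAverage ℝ f (g.compContinuous ⟨f, hf⟩) (n i) (x i) =
      birkhoffAverage ℝ f g (n i) (f (x i)) := by
    simp only [birkhoffAverage, birkhoffSum, compContinuous_apply, ContinuousMap.coe_mk,
      ← Function.iterate_succ_apply, ← Function.iterate_succ_apply']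
  rw [hν, integral_orbitEmpiricalMeasure, integral_orbitEmpiricalMeasure, hshift,
    ← dist_eq_norm, dist_birkhoffAverage_apply_birkhoffAverage, Function.comp_apply]
  gcongr
  exact g.dist_le_two_norm _ _

/-- If Birkhoff sums of a continuous `ψ` of arbitrarily large lengths are at most `c·n`
at some points, then some `f`-invariant Borel probability measure `μ` on the nonempty
compact metric space `X` satisfies `∫ ψ dμ ≤ c`. -/
theorem stmt5 {X : Type*} [MetricSpace X] [CompactSpace X] [Nonempty X]
    [MeasurableSpace X] [BorelSpace X]
    (f : X → X) (hf : Continuous f) (ψ : X → ℝ) (hψ : Continuous ψ) (c : ℝ)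
    (hsum : ∀ N : ℕ, ∃ n : ℕ, N ≤ n ∧ ∃ x : X,
      ∑ k ∈ Finset.range n, ψ (f^[k] x) ≤ c * n) :
    ∃ μ : Measure X, IsProbabilityMeasure μ ∧ μ.map f = μ ∧ ∫ a, ψ a ∂μ ≤ c := by
  choose n hn x hx using fun N : ℕ => hsum (N + 1)
  have hn0 (N : ℕ) : n N ≠ 0 := by have := hn N; omega
  let ν (N : ℕ) : ProbabilityMeasure X :=
    ⟨orbitEmpiricalMeasure f (n N) (x N),
      isProbabilityMeasure_orbitEmpiricalMeasure f (hn0 N) (x N)⟩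
  obtain ⟨μ, -, hμ⟩ := isCompact_univ.ultrafilter_le_nhds ((hyperfilter ℕ).map ν) (by simp)
  have hμ : Tendsto ν (hyperfilter ℕ) (𝓝 μ) := hμ
  have hn_top : Tendsto n (hyperfilter ℕ) atTop :=
    (tendsto_atTop_mono (fun N => (Nat.le_succ N).trans (hn N)) tendsto_id).mono_left
      Nat.hyperfilter_le_atTop
  refine ⟨μ, inferInstance,
    map_eq_of_tendsto_orbitEmpiricalMeasure hf hn_top (fun _ => rfl) hμ, ?_⟩
  refine le_of_tendsto
    (ProbabilityMeasure.tendsto_iff_forall_integral_tendsto.1 hμ (mkOfCompact ⟨ψ, hψ⟩))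
    (Eventually.of_forall fun N => ?_)
  have hpos : (0 : ℝ) < n N := by exact_mod_cast Nat.pos_of_ne_zero (hn0 N)
  calc ∫ a, ψ a ∂(orbitEmpiricalMeasure f (n N) (x N))
      = (n N : ℝ)⁻¹ * ∑ k ∈ Finset.range (n N), ψ (f^[k] (x N)) :=
        integral_orbitEmpiricalMeasure f _ _ ψ
    _ ≤ c := by
        rw [inv_mul_le_iff₀ hpos, mul_comm]
        exact hx N
end

section
/- Let X be a nonempty compact metric space, f : X → X a continuous map, and ψ : X → ℝ a continuous function. Suppose that every f-invariant Borel probability measure μ on X satisfies ∫ ψ dμ > 0. Then there exists an integer N ≥ 1 such that Σ_{k=0}^{N−1} ψ(f^[k](x)) > 0 for every x ∈ X. -/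
open MeasureTheory

open Filter Topology
open scoped BoundedContinuousFunction

/-- The empirical measure `n⁻¹ ∑_{k<n} δ_{f^[k] x}` along an orbit integrates a function to its
Birkhoff average. -/
theorem exists_probabilityMeasure_integral_eq_birkhoffAverage {X : Type*} [MeasurableSpace X]
    [MeasurableSingletonClass X] (f : X → X) (x : X) {n : ℕ} (hn : n ≠ 0) :
    ∃ μ : ProbabilityMeasure X, ∀ g : X → ℝ, ∫ a, g a ∂(μ : Measure X) =
      birkhoffAverage ℝ f g n x := by
  refine ⟨⟨(n : ENNReal)⁻¹ • ∑ k ∈ Finset.range n, Measure.dirac (f^[k] x), ⟨?_⟩⟩, fun g ↦ ?_⟩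
  · simp [ENNReal.inv_mul_cancel (Nat.cast_ne_zero.2 hn) (ENNReal.natCast_ne_top n)]
  · rw [ProbabilityMeasure.coe_mk, integral_smul_measure,
      integral_finsetSum_measure fun k _ ↦ integrable_dirac (by simp)]
    simp [birkhoffAverage, birkhoffSum]

/-- **Krylov–Bogolyubov**: the weak limit of measures integrating to Birkhoff averages of
lengths tending to infinity is invariant. -/
theorem map_eq_of_tendsto_birkhoffAverage {ι X : Type*} [TopologicalSpace X]
    [HasOuterApproxClosed X] [MeasurableSpace X] [BorelSpace X] {f : X → X} (hf : Continuous f)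
    {l : Filter ι} [l.NeBot] {u : ι → ℕ} (hu : Tendsto u l atTop) (x : ι → X)
    {μ : ProbabilityMeasure X} (h : ∀ g : X →ᵇ ℝ,
      Tendsto (fun i ↦ birkhoffAverage ℝ f g (u i) (x i)) l (𝓝 (∫ a, g a ∂(μ : Measure X)))) :
    (μ : Measure X).map f = μ := by
  have := Measure.isProbabilityMeasure_map (μ := (μ : Measure X)) hf.aemeasurable
  refine ext_of_forall_integral_eq_of_IsFiniteMeasure fun g ↦ ?_
  rw [integral_map hf.aemeasurable g.continuous.aestronglyMeasurable]
  refine sub_eq_zero.1 (tendsto_nhds_unique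
    ((h (g.compContinuous ⟨f, hf⟩)).sub (h g)) ?_)
  refine squeeze_zero_norm (a := fun i ↦ 2 * ‖g‖ / u i) (fun i ↦ ?_)
    (tendsto_const_nhds.div_atTop (tendsto_natCast_atTop_atTop.comp hu))
  have key : birkhoffAverage ℝ f (g.compContinuous ⟨f, hf⟩) (u i) (x i) =
      birkhoffAverage ℝ f g (u i) (f (x i)) := by
    simp [birkhoffAverage, birkhoffSum, ← Function.iterate_succ_apply,
      Function.iterate_succ_apply']
  rw [key, ← dist_eq_norm, dist_birkhoffAverage_apply_birkhoffAverage]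
  gcongr
  exact g.dist_le_two_norm _ _

/-- Uniform positivity of Birkhoff sums: if every `f`-invariant Borel probability
measure `μ` on the nonempty compact metric space `X` satisfies `∫ ψ dμ > 0` for a
continuous `ψ`, then there is `N ≥ 1` with `∑_{k<N} ψ (f^[k] x) > 0` for every `x`. -/
theorem stmt6 {X : Type*} [MetricSpace X] [CompactSpace X] [Nonempty X]
    [MeasurableSpace X] [BorelSpace X]
    (f : X → X) (hf : Continuous f) (ψ : X → ℝ) (hψ : Continuous ψ)
    (hpos : ∀ μ : Measure X, IsProbabilityMeasure μ → μ.map f = μ →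
      0 < ∫ a, ψ a ∂μ) :
    ∃ N : ℕ, 1 ≤ N ∧ ∀ x : X, 0 < ∑ k ∈ Finset.range N, ψ (f^[k] x) := by
  by_contra! H
  choose x hx using fun n : ℕ ↦ H (n + 1) n.succ_pos
  choose μ hμ using fun n : ℕ ↦
    exists_probabilityMeasure_integral_eq_birkhoffAverage f (x n) n.succ_ne_zero
  let U : Ultrafilter ℕ := hyperfilter ℕ
  have hU : (U : Filter ℕ) ≤ atTop := Nat.hyperfilter_le_atTop
  obtain ⟨ν, -, hν⟩ := isCompact_univ.ultrafilter_le_nhds (U.map μ) (by simp)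
  have hlim : ∀ g : X →ᵇ ℝ, Tendsto (fun n ↦ birkhoffAverage ℝ f g (n + 1) (x n)) U
      (𝓝 (∫ a, g a ∂(ν : Measure X))) := fun g ↦ by
    simpa only [hμ] using
      ProbabilityMeasure.tendsto_iff_forall_integral_tendsto.1 (show Tendsto μ U (𝓝 ν) from hν) g
  refine (hpos ν inferInstance <| map_eq_of_tendsto_birkhoffAverage hf
    ((tendsto_add_atTop_nat 1).mono_left hU) x hlim).not_ge ?_
  refine le_of_tendsto (hlim (BoundedContinuousFunction.mkOfCompact ⟨ψ, hψ⟩))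
    (Eventually.of_forall fun n ↦ ?_)
  exact mul_nonpos_of_nonneg_of_nonpos (by positivity) (hx n)
end
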